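/- arXiv:2411.12673 — 5 statements merged into one kernel-verified Lean document; each statement's English description precedes it below -/
import Mathlib

section
/- Let Λ be a Borel measure on [0,∞)² with Lebesgue margins, i.e., Λ([0,u] × [0,∞)) = u and Λ([0,∞) × [0,u]) = u for every u ≥ 0. Then for all x₁, x₂, y₁, y₂ ≥ 0, the measure of the symmetric difference of the corner regions satisfies Λ(A_{(x₁,y₁)} Δ A_{(x₂,y₂)}) ≤ |x₁ − x₂| + |y₁ − y₂|, where A_{(x,y)} = {(u₁, u₂) ∈ [0,∞)² : u₁ ≤ x or u₂ ≤ y}. -/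
open MeasureTheory

/-- If an increasing family of measurable sets `S u`, `u ≥ 0`, satisfies `μ (S u) = u`, then the
symmetric difference of two of its members has measure at most the distance of the indices. -/
theorem measure_symmDiff_le_abs_sub {α : Type*} [MeasurableSpace α] (μ : Measure α)
    {S : ℝ → Set α} (hmono : Monotone S) (hmeas : ∀ u, MeasurableSet (S u))
    (hμ : ∀ u, 0 ≤ u → μ (S u) = ENNReal.ofReal u) {a b : ℝ} (ha : 0 ≤ a) (hb : 0 ≤ b) :
    μ (symmDiff (S a) (S b)) ≤ ENNReal.ofReal |a - b| := by
  wlog h : a ≤ b generalizing a b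
  · rw [symmDiff_comm, abs_sub_comm]
    exact this hb ha (le_of_not_ge h)
  · rw [symmDiff_of_le (hmono h), measure_sdiff (hmono h) (hmeas a).nullMeasurableSet
      (by simp [hμ a ha]), hμ a ha, hμ b hb, ← ENNReal.ofReal_sub b ha, abs_sub_comm,
      abs_of_nonneg (sub_nonneg.2 h)]

theorem stmt12 (Λ : Measure (ℝ × ℝ))
    (hm1 : ∀ u : ℝ, 0 ≤ u → Λ (Set.Icc 0 u ×ˢ Set.Ici 0) = ENNReal.ofReal u)
    (hm2 : ∀ u : ℝ, 0 ≤ u → Λ (Set.Ici 0 ×ˢ Set.Icc 0 u) = ENNReal.ofReal u)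
    (x₁ y₁ x₂ y₂ : ℝ) (hx₁ : 0 ≤ x₁) (hy₁ : 0 ≤ y₁) (hx₂ : 0 ≤ x₂) (hy₂ : 0 ≤ y₂) :
    Λ (symmDiff {u : ℝ × ℝ | (0 ≤ u.1 ∧ 0 ≤ u.2) ∧ (u.1 ≤ x₁ ∨ u.2 ≤ y₁)}
        {u : ℝ × ℝ | (0 ≤ u.1 ∧ 0 ≤ u.2) ∧ (u.1 ≤ x₂ ∨ u.2 ≤ y₂)}) ≤
      ENNReal.ofReal (|x₁ - x₂| + |y₁ - y₂|) := by
  have hx := measure_symmDiff_le_abs_sub Λ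
    (S := fun u => Set.Icc (0 : ℝ) u ×ˢ Set.Ici (0 : ℝ))
    (fun _ _ h => Set.prod_mono (Set.Icc_subset_Icc_right h) subset_rfl)
    (fun _ => measurableSet_Icc.prod measurableSet_Ici) hm1 hx₁ hx₂
  have hy := measure_symmDiff_le_abs_sub Λ
    (S := fun u => Set.Ici (0 : ℝ) ×ˢ Set.Icc (0 : ℝ) u)
    (fun _ _ h => Set.prod_mono subset_rfl (Set.Icc_subset_Icc_right h))
    (fun _ => measurableSet_Ici.prod measurableSet_Icc) hm2 hy₁ hy₂
  rw [ENNReal.ofReal_add (abs_nonneg _) (abs_nonneg _)]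
  refine (measure_mono ?_).trans ((measure_union_le _ _).trans (add_le_add hx hy))
  intro u
  simp only [Set.mem_symmDiff, Set.mem_union, Set.mem_prod, Set.mem_Icc, Set.mem_Ici,
    Set.mem_ofPred_eq]
  tauto
end

section
/- Fix a real number p ≥ 1 and define f(ψ) = (sin ψ − cos ψ) · ((sin ψ)^p + (cos ψ)^p)^{−1/p} for ψ ∈ [0, π/2]. Then: (i) |f(ψ)| ≤ 1 for all ψ ∈ [0, π/2]; (ii) f is differentiable on (0, π/2) with derivative f'(ψ) = ((sin ψ)^{p−1} + (cos ψ)^{p−1}) · ((sin ψ)^p + (cos ψ)^p)^{−(1+p)/p}; and (iii) 0 ≤ f'(ψ) ≤ 2 for all ψ ∈ (0, π/2). -/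
open Real

/-- A nonnegative number is at most the `p`-norm of a pair containing it. -/
lemma le_rpow_add_rpow_left {a b p : ℝ} (ha : 0 ≤ a) (hb : 0 ≤ b) (hp : 0 < p) :
    a ≤ (a ^ p + b ^ p) ^ (1 / p) := by
  have hbp : 0 ≤ b ^ p := rpow_nonneg hb p
  calc a = (a ^ p) ^ (1 / p) := by
        rw [one_div, rpow_rpow_inv ha hp.ne']
    _ ≤ (a ^ p + b ^ p) ^ (1 / p) :=
        rpow_le_rpow (rpow_nonneg ha p) (by linarith) (by positivity)

lemma le_rpow_add_rpow_right {a b p : ℝ} (ha : 0 ≤ a) (hb : 0 ≤ b) (hp : 0 < p) :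
    b ≤ (a ^ p + b ^ p) ^ (1 / p) := by
  rw [add_comm]
  exact le_rpow_add_rpow_left hb ha hp

lemma rpow_eq_rpow_sub_one_mul {a : ℝ} (ha : 0 < a) (p : ℝ) : a ^ p = a ^ (p - 1) * a := by
  rw [rpow_sub_one ha.ne', div_mul_cancel₀ _ ha.ne']

lemma abs_sub_mul_rpow_add_rpow_le_one {a b p : ℝ} (ha : 0 ≤ a) (hb : 0 ≤ b) (hp : 0 < p) :
    |(a - b) * (a ^ p + b ^ p) ^ (-(1 / p))| ≤ 1 := by
  have hS : 0 ≤ a ^ p + b ^ p := add_nonneg (rpow_nonneg ha p) (rpow_nonneg hb p)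
  have hN : 0 ≤ (a ^ p + b ^ p) ^ (1 / p) := rpow_nonneg hS _
  have h₁ := le_rpow_add_rpow_left ha hb hp
  have h₂ := le_rpow_add_rpow_right ha hb hp
  rw [rpow_neg hS, abs_mul, abs_of_nonneg (inv_nonneg.2 hN), ← div_eq_mul_inv]
  exact div_le_one_of_le₀ (abs_le.2 ⟨by linarith, by linarith⟩) hN

/-- Chebyshev's sum inequality for the pairs `(a ^ q, b ^ q)` and `(a, b)`. -/
lemma rpow_mul_add_rpow_mul_swap_le {a b q : ℝ} (ha : 0 ≤ a) (hb : 0 ≤ b) (hq : 0 ≤ q) :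
    a ^ q * b + b ^ q * a ≤ a ^ q * a + b ^ q * b := by
  rcases le_total a b with h | h
  · nlinarith [rpow_le_rpow ha h hq]
  · nlinarith [rpow_le_rpow hb h hq]

lemma rpow_sub_one_add_mul_rpow_le_two {a b p : ℝ} (ha : 0 < a) (hb : 0 < b) (hp : 1 ≤ p)
    (hab : a ^ 2 + b ^ 2 = 1) :
    (a ^ (p - 1) + b ^ (p - 1)) * (a ^ p + b ^ p) ^ (-((1 + p) / p)) ≤ 2 := by
  have hp₀ : 0 < p := by linarith
  have hS : 0 < a ^ p + b ^ p := by positivity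
  have h₁ := le_rpow_add_rpow_left ha.le hb.le hp₀
  have h₂ := le_rpow_add_rpow_right ha.le hb.le hp₀
  have h₃ := rpow_mul_add_rpow_mul_swap_le ha.le hb.le (sub_nonneg.2 hp)
  have hA : 0 < a ^ (p - 1) := by positivity
  have hB : 0 < b ^ (p - 1) := by positivity
  have hN : 0 < (a ^ p + b ^ p) ^ (1 / p) := by positivity
  have hexp : (1 + p) / p = 1 / p + 1 := by field_simp
  rw [rpow_neg hS.le, ← div_eq_mul_inv, div_le_iff₀ (by positivity), hexp, rpow_add_one hS.ne']
  have hSe : a ^ p + b ^ p = a ^ (p - 1) * a + b ^ (p - 1) * b := by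
    rw [← rpow_eq_rpow_sub_one_mul ha, ← rpow_eq_rpow_sub_one_mul hb]
  generalize (a ^ p + b ^ p) ^ (1 / p) = N at *
  rw [hSe]
  generalize a ^ (p - 1) = A at *
  generalize b ^ (p - 1) = B at *
  calc A + B = (A + B) * (a ^ 2 + b ^ 2) := by rw [hab, mul_one]
    _ = (A + B) * a * a + (A + B) * b * b := by ring
    _ ≤ (A + B) * a * N + (A + B) * b * N := by gcongr
    _ = N * ((A * a + B * b) + (A * b + B * a)) := by ring
    _ ≤ N * ((A * a + B * b) + (A * a + B * b)) := by gcongr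
    _ = 2 * (N * (A * a + B * b)) := by ring

lemma hasDerivAt_sin_sub_cos_mul_rpow {p ψ : ℝ} (hp : p ≠ 0) (hs : 0 < sin ψ)
    (hc : 0 < cos ψ) :
    HasDerivAt (fun t : ℝ => (sin t - cos t) * (sin t ^ p + cos t ^ p) ^ (-(1 / p)))
      ((sin ψ ^ (p - 1) + cos ψ ^ (p - 1)) *
        (sin ψ ^ p + cos ψ ^ p) ^ (-((1 + p) / p))) ψ := by
  have hS : 0 < sin ψ ^ p + cos ψ ^ p := by positivity
  have h := ((hasDerivAt_sin ψ).sub (hasDerivAt_cos ψ)).mul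
    ((((hasDerivAt_sin ψ).rpow_const (p := p) (Or.inl hs.ne')).add
      ((hasDerivAt_cos ψ).rpow_const (p := p) (Or.inl hc.ne'))).rpow_const
        (p := -(1 / p)) (Or.inl hS.ne'))
  refine h.congr_deriv ?_
  have hexp : -((1 + p) / p) = -(1 / p) - 1 := by field_simp; ring
  have hSe : sin ψ ^ p + cos ψ ^ p =
      sin ψ ^ (p - 1) * sin ψ + cos ψ ^ (p - 1) * cos ψ := by
    rw [← rpow_eq_rpow_sub_one_mul hs, ← rpow_eq_rpow_sub_one_mul hc]
  simp only [Pi.add_apply, Pi.sub_apply]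
  rw [hexp, rpow_eq_rpow_sub_one_mul hS (-(1 / p))]
  generalize (sin ψ ^ p + cos ψ ^ p) ^ (-(1 / p) - 1) = M
  rw [hSe]
  field_simp
  linear_combination (M * (sin ψ ^ (p - 1) + cos ψ ^ (p - 1))) * sin_sq_add_cos_sq ψ

theorem stmt14 (p : ℝ) (hp : 1 ≤ p) :
    (∀ ψ ∈ Set.Icc (0:ℝ) (π/2),
      |(Real.sin ψ - Real.cos ψ) * ((Real.sin ψ) ^ p + (Real.cos ψ) ^ p) ^ (-(1/p))| ≤ 1) ∧
    (∀ ψ ∈ Set.Ioo (0:ℝ) (π/2),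
      HasDerivAt
        (fun t : ℝ =>
          (Real.sin t - Real.cos t) * ((Real.sin t) ^ p + (Real.cos t) ^ p) ^ (-(1/p)))
        (((Real.sin ψ) ^ (p-1) + (Real.cos ψ) ^ (p-1)) *
          ((Real.sin ψ) ^ p + (Real.cos ψ) ^ p) ^ (-((1+p)/p))) ψ) ∧
    (∀ ψ ∈ Set.Ioo (0:ℝ) (π/2),
      0 ≤ ((Real.sin ψ) ^ (p-1) + (Real.cos ψ) ^ (p-1)) *
          ((Real.sin ψ) ^ p + (Real.cos ψ) ^ p) ^ (-((1+p)/p)) ∧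
      ((Real.sin ψ) ^ (p-1) + (Real.cos ψ) ^ (p-1)) *
          ((Real.sin ψ) ^ p + (Real.cos ψ) ^ p) ^ (-((1+p)/p)) ≤ 2) := by
  have hp₀ : 0 < p := by linarith
  have hs : ∀ ψ ∈ Set.Ioo (0:ℝ) (π/2), 0 < sin ψ := fun ψ h =>
    sin_pos_of_pos_of_lt_pi h.1 (by linarith [h.2, pi_pos])
  have hc : ∀ ψ ∈ Set.Ioo (0:ℝ) (π/2), 0 < cos ψ := fun ψ h =>
    cos_pos_of_mem_Ioo ⟨by linarith [h.1, pi_pos], h.2⟩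
  refine ⟨fun ψ h => ?_, fun ψ h => ?_, fun ψ h => ⟨?_, ?_⟩⟩
  · exact abs_sub_mul_rpow_add_rpow_le_one
      (sin_nonneg_of_nonneg_of_le_pi h.1 (by linarith [h.2, pi_pos]))
      (cos_nonneg_of_mem_Icc ⟨by linarith [h.1, pi_pos], h.2⟩) hp₀
  · exact hasDerivAt_sin_sub_cos_mul_rpow hp₀.ne' (hs ψ h) (hc ψ h)
  · have := hs ψ h
    have := hc ψ h
    positivity
  · exact rpow_sub_one_add_mul_rpow_le_two (hs ψ h) (hc ψ h) hp (sin_sq_add_cos_sq ψ)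
end

section
/- Fix a real number p ≥ 1, set f(ψ) = (sin ψ − cos ψ)·((sin ψ)^p + (cos ψ)^p)^{−1/p} and f'(ψ) = ((sin ψ)^{p−1} + (cos ψ)^{p−1})·((sin ψ)^p + (cos ψ)^p)^{−(1+p)/p}. Let Q be a Borel probability measure on [0, π/2] with Q({0}) = 0, ∫ f dQ = 0 and σ² := ∫ f² dQ > 0. For a probability measure μ on [0, π/2] with ∫ (f − μ(f))² dμ > 0, where μ(f) = ∫ f dμ, define Ψ(μ)(θ) = μ([0,θ]) − (μ(f)/∫(f − μ(f))² dμ) · ∫_{[0,θ]} (f(ψ) − μ(f)) dμ(ψ). Let h : [0, π/2] → ℝ be continuous with h(0) = h(π/2) = 0, let t_n → 0⁺ be positive reals, let h_n : [0,π/2] → ℝ be bounded functions with sup_θ |h_n(θ) − h(θ)| → 0, and let μ_n be Borel probability measures on [0, π/2] with μ_n([0,θ]) = Q([0,θ]) + t_n h_n(θ) for all θ ∈ [0, π/2] and ∫(f − μ_n(f))² dμ_n > 0. Then sup_{θ ∈ [0,π/2]} | (Ψ(μ_n)(θ) − Ψ(Q)(θ))/t_n − D_h(θ) | → 0 as n →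 ∞, where D_h(θ) = h(θ) + (σ²)^{−1} (∫_0^{π/2} h(ψ) f'(ψ) dψ) · ∫_{[0,θ]} f(ψ) dQ(ψ). (This is the Hadamard differentiability of the empirical Euclidean likelihood map Ψ at Q, tangentially to continuous functions vanishing at the boundary, with the stated derivative.) -/
open MeasureTheory Real

noncomputable def momF (p : ℝ) (ψ : ℝ) : ℝ :=
  (Real.sin ψ - Real.cos ψ) * ((Real.sin ψ) ^ p + (Real.cos ψ) ^ p) ^ (-(1/p))

noncomputable def momF' (p : ℝ) (ψ : ℝ) : ℝ :=
  ((Real.sin ψ) ^ (p-1) + (Real.cos ψ) ^ (p-1)) *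
    ((Real.sin ψ) ^ p + (Real.cos ψ) ^ p) ^ (-((1+p)/p))

/-- The empirical Euclidean likelihood map `Ψ`:
`Ψ(μ)(θ) = μ([0,θ]) − (μ(f)/∫(f−μ(f))² dμ) ∫_{[0,θ]} (f − μ(f)) dμ`. -/
noncomputable def PsiMap (p : ℝ) (μ : Measure ℝ) (θ : ℝ) : ℝ :=
  (μ (Set.Icc 0 θ)).toReal -
    ((∫ ψ, momF p ψ ∂μ) / (∫ ψ, (momF p ψ - ∫ ψ', momF p ψ' ∂μ) ^ 2 ∂μ)) *
      ∫ ψ in Set.Icc 0 θ, (momF p ψ - ∫ ψ', momF p ψ' ∂μ) ∂μ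

/-- Integration by parts against the distribution function of a finite measure. -/
theorem setIntegral_Icc_eq_sub_integral_cdf (ν : Measure ℝ) [IsFiniteMeasure ν]
    {g g' : ℝ → ℝ} {a b : ℝ} (hg : ContinuousOn g (Set.Icc a b))
    (hg' : ContinuousOn g' (Set.Icc a b))
    (hderiv : ∀ x ∈ Set.Ioo a b, HasDerivAt g (g' x) x) :
    ∫ ψ in Set.Icc a b, g ψ ∂ν =
      g b * (ν (Set.Icc a b)).toReal -
        ∫ x in Set.Icc a b, g' x * (ν (Set.Icc a x)).toReal := by
  have hg'int : Integrable g' (volume.restrict (Set.Icc a b)) := hg'.integrableOn_Icc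
  have hmeas : MeasurableSet {z : ℝ × ℝ | z.1 ≤ z.2} :=
    measurableSet_le measurable_fst measurable_snd
  have hprod : Integrable (fun z : ℝ × ℝ => {z : ℝ × ℝ | z.1 ≤ z.2}.indicator
      (fun z => g' z.2) z) ((ν.restrict (Set.Icc a b)).prod (volume.restrict (Set.Icc a b))) :=
    (hg'int.comp_snd _).indicator hmeas
  have hftc : ∀ ψ ∈ Set.Icc a b, g ψ = g b -
      ∫ x in Set.Icc a b, {z : ℝ × ℝ | z.1 ≤ z.2}.indicator (fun z => g' z.2) (ψ, x) := by
    intro ψ hψ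
    have hsub : Set.Icc ψ b ⊆ Set.Icc a b := Set.Icc_subset_Icc_left hψ.1
    have h1 := intervalIntegral.integral_eq_sub_of_hasDerivAt_of_le hψ.2 (hg.mono hsub)
      (fun x hx => hderiv x ⟨hψ.1.trans_lt hx.1, hx.2⟩)
      ((hg'.mono hsub).intervalIntegrable_of_Icc hψ.2)
    rw [intervalIntegral.integral_of_le hψ.2, ← integral_Icc_eq_integral_Ioc] at h1
    have h2 : (fun x => {z : ℝ × ℝ | z.1 ≤ z.2}.indicator (fun z => g' z.2) (ψ, x)) =
        (Set.Ici ψ).indicator g' := by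
      ext x
      simp [Set.indicator_apply]
    rw [h2, setIntegral_indicator measurableSet_Ici]
    have h3 : Set.Icc a b ∩ Set.Ici ψ = Set.Icc ψ b := by
      ext x
      simp only [Set.mem_inter_iff, Set.mem_Icc, Set.mem_Ici]
      exact ⟨fun hx => ⟨hx.2, hx.1.2⟩, fun hx => ⟨⟨hψ.1.trans hx.1, hx.2⟩, hx.1⟩⟩
    rw [h3, h1]
    ring
  rw [setIntegral_congr_fun measurableSet_Icc hftc,
    integral_sub (integrable_const _) hprod.integral_prod_left,
    integral_integral_swap (f := fun ψ x => {z : ℝ × ℝ | z.1 ≤ z.2}.indicator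
      (fun z => g' z.2) (ψ, x)) hprod]
  congr 1
  · simp [Measure.real, mul_comm]
  · refine setIntegral_congr_fun measurableSet_Icc fun x hx => ?_
    have h2 : (fun ψ => {z : ℝ × ℝ | z.1 ≤ z.2}.indicator (fun z => g' z.2) (ψ, x)) =
        (Set.Iic x).indicator fun _ => g' x := by
      ext ψ
      simp [Set.indicator_apply]
    have h3 : Set.Icc a b ∩ Set.Iic x = Set.Icc a x := by
      ext ψ
      simp only [Set.mem_inter_iff, Set.mem_Icc, Set.mem_Iic]
      exact ⟨fun hψ => ⟨hψ.1.1, hψ.2⟩, fun hψ => ⟨⟨hψ.1, hψ.2.trans hx.2⟩, hψ.2⟩⟩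
    simp only [h2]
    rw [setIntegral_indicator measurableSet_Iic, h3]
    simp [Measure.real, mul_comm]

theorem measurable_toReal_measure_Icc (ν : Measure ℝ) [IsFiniteMeasure ν] (a : ℝ) :
    Measurable fun x => (ν (Set.Icc a x)).toReal :=
  Monotone.measurable fun _ _ hxy =>
    ENNReal.toReal_mono (measure_ne_top _ _) (measure_mono (Set.Icc_subset_Icc_right hxy))

theorem ContinuousOn.integrableOn_mul_measure_Icc {g' : ℝ → ℝ} {a b : ℝ}
    (hg' : ContinuousOn g' (Set.Icc a b)) (ν : Measure ℝ) [IsFiniteMeasure ν] :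
    IntegrableOn (fun x => g' x * (ν (Set.Icc a x)).toReal) (Set.Icc a b) := by
  refine Integrable.mul_bdd (c := (ν Set.univ).toReal) hg'.integrableOn_Icc
    (measurable_toReal_measure_Icc ν a).aestronglyMeasurable (ae_of_all _ fun x => ?_)
  rw [Real.norm_of_nonneg ENNReal.toReal_nonneg]
  exact ENNReal.toReal_mono (measure_ne_top _ _) (measure_mono (Set.subset_univ _))

/-- The change of `∫ g` over an interval when the distribution function moves by `t * k`. -/
theorem setIntegral_Icc_sub_of_cdf_eq_add (μ ν : Measure ℝ) [IsFiniteMeasure μ]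
    [IsFiniteMeasure ν] {g g' : ℝ → ℝ} {a b : ℝ} (hab : a ≤ b) (hg : ContinuousOn g (Set.Icc a b))
    (hg' : ContinuousOn g' (Set.Icc a b)) (hderiv : ∀ x ∈ Set.Ioo a b, HasDerivAt g (g' x) x)
    {t : ℝ} {k : ℝ → ℝ} (hcdf : ∀ x ∈ Set.Icc a b,
      (μ (Set.Icc a x)).toReal = (ν (Set.Icc a x)).toReal + t * k x) :
    ∫ ψ in Set.Icc a b, g ψ ∂μ - ∫ ψ in Set.Icc a b, g ψ ∂ν =
      t * (g b * k b - ∫ x in Set.Icc a b, k x * g' x) := by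
  have hint : (∫ x in Set.Icc a b, g' x * (μ (Set.Icc a x)).toReal) -
      ∫ x in Set.Icc a b, g' x * (ν (Set.Icc a x)).toReal =
        t * ∫ x in Set.Icc a b, k x * g' x := by
    rw [← integral_sub (hg'.integrableOn_mul_measure_Icc μ) (hg'.integrableOn_mul_measure_Icc ν),
      ← integral_const_mul]
    refine setIntegral_congr_fun measurableSet_Icc fun x hx => ?_
    simp only [hcdf x hx]
    ring
  rw [setIntegral_Icc_eq_sub_integral_cdf μ hg hg' hderiv,
    setIntegral_Icc_eq_sub_integral_cdf ν hg hg' hderiv, hcdf b ⟨hab, le_rfl⟩]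
  linear_combination -hint

theorem sin_rpow_add_cos_rpow_pos (p : ℝ) {ψ : ℝ} (hψ : ψ ∈ Set.Icc 0 (π / 2)) :
    0 < Real.sin ψ ^ p + Real.cos ψ ^ p := by
  have hs : 0 ≤ Real.sin ψ := Real.sin_nonneg_of_nonneg_of_le_pi hψ.1 (by linarith [hψ.2, pi_pos])
  have hc : 0 ≤ Real.cos ψ := Real.cos_nonneg_of_neg_pi_div_two_le_of_le
    (by linarith [hψ.1, pi_pos]) hψ.2
  rcases hs.eq_or_lt with h | h
  · have : 0 < Real.cos ψ := by
      refine hc.lt_of_ne fun h' => ?_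
      have := Real.sin_sq_add_cos_sq ψ
      rw [← h, ← h'] at this
      norm_num at this
    have := Real.rpow_pos_of_pos this p
    have := Real.rpow_nonneg hs p
    linarith
  · have := Real.rpow_pos_of_pos h p
    have := Real.rpow_nonneg hc p
    linarith

theorem continuousOn_momF {p : ℝ} (hp : 1 ≤ p) : ContinuousOn (momF p) (Set.Icc 0 (π / 2)) := by
  have hp0 : 0 ≤ p := by linarith
  refine ContinuousOn.mul (by fun_prop) (ContinuousOn.rpow_const ?_
    fun x hx => Or.inl (sin_rpow_add_cos_rpow_pos p hx).ne')
  exact ((Real.continuous_sin.rpow_const fun _ => Or.inr hp0).add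
    (Real.continuous_cos.rpow_const fun _ => Or.inr hp0)).continuousOn

theorem continuousOn_momF' {p : ℝ} (hp : 1 ≤ p) : ContinuousOn (momF' p) (Set.Icc 0 (π / 2)) := by
  have hp0 : 0 ≤ p := by linarith
  have hp1 : 0 ≤ p - 1 := by linarith
  refine ContinuousOn.mul ?_ (ContinuousOn.rpow_const ?_
    fun x hx => Or.inl (sin_rpow_add_cos_rpow_pos p hx).ne')
  · exact ((Real.continuous_sin.rpow_const fun _ => Or.inr hp1).add
      (Real.continuous_cos.rpow_const fun _ => Or.inr hp1)).continuousOn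
  · exact ((Real.continuous_sin.rpow_const fun _ => Or.inr hp0).add
      (Real.continuous_cos.rpow_const fun _ => Or.inr hp0)).continuousOn

theorem hasDerivAt_momF {p : ℝ} (hp : 1 ≤ p) {x : ℝ} (hx : x ∈ Set.Ioo 0 (π / 2)) :
    HasDerivAt (momF p) (momF' p x) x := by
  have hs : 0 < Real.sin x := Real.sin_pos_of_pos_of_lt_pi hx.1 (by linarith [hx.2, pi_pos])
  have hc : 0 < Real.cos x := Real.cos_pos_of_mem_Ioo ⟨by linarith [hx.1, pi_pos], hx.2⟩
  have hN := sin_rpow_add_cos_rpow_pos p ⟨hx.1.le, hx.2.le⟩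
  have hp0 : p ≠ 0 := by linarith
  have hd := ((Real.hasDerivAt_sin x).sub (Real.hasDerivAt_cos x)).mul
    ((((Real.hasDerivAt_sin x).rpow_const (p := p) (Or.inl hs.ne')).add
      ((Real.hasDerivAt_cos x).rpow_const (p := p) (Or.inl hc.ne'))).rpow_const
        (p := -(1 / p)) (Or.inl hN.ne'))
  refine hd.congr_deriv ?_
  have e1 : -((1 + p) / p) = -(1 / p) - 1 := by field_simp; ring
  have e2 : (Real.sin x ^ p + Real.cos x ^ p) ^ (-(1 / p)) =
      (Real.sin x ^ p + Real.cos x ^ p) ^ (-(1 / p) - 1) *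
        (Real.sin x ^ p + Real.cos x ^ p) := by
    rw [Real.rpow_sub_one hN.ne']
    field_simp
  have e3 : Real.sin x ^ p = Real.sin x ^ (p - 1) * Real.sin x := by
    rw [Real.rpow_sub_one hs.ne']
    field_simp
  have e4 : Real.cos x ^ p = Real.cos x ^ (p - 1) * Real.cos x := by
    rw [Real.rpow_sub_one hc.ne']
    field_simp
  simp only [Pi.add_apply, Pi.sub_apply]
  rw [momF', e1, e2]
  generalize (Real.sin x ^ p + Real.cos x ^ p) ^ (-(1 / p) - 1) = A
  rw [e3, e4]
  generalize Real.sin x ^ (p - 1) = u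
  generalize Real.cos x ^ (p - 1) = v
  have hp1 : 1 / p * p = 1 := by field_simp
  have hsc := Real.sin_sq_add_cos_sq x
  generalize Real.sin x = s at *
  generalize Real.cos x = c at *
  linear_combination (A * (u + v)) * hsc - (s - c) * A * (u * c - v * s) * hp1

/-- Products of a convergent scalar sequence with a uniformly convergent sequence whose limit is
bounded. -/
theorem TendstoUniformlyOn.scalar_mul_of_bounded {c : ℕ → ℝ} {c₀ : ℝ} {G : ℕ → ℝ → ℝ} {g : ℝ → ℝ}
    {S : Set ℝ} {e : ℕ → ℝ} {B : ℝ} (hc : Filter.Tendsto c Filter.atTop (nhds c₀))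
    (he : Filter.Tendsto e Filter.atTop (nhds 0))
    (hG : ∀ᶠ n in Filter.atTop, ∀ x ∈ S, |G n x - g x| ≤ e n) (hg : ∀ x ∈ S, |g x| ≤ B) :
    TendstoUniformlyOn (fun n x => c n * G n x) (fun x => c₀ * g x) Filter.atTop S := by
  rw [Metric.tendstoUniformlyOn_iff]
  intro ε hε
  have hlim : Filter.Tendsto (fun n => |c n| * e n + |c n - c₀| * B) Filter.atTop (nhds 0) := by
    have h1 := hc.abs.mul he
    have h2 := ((hc.sub_const c₀).abs).mul_const B
    simpa using h1.add h2
  filter_upwards [hlim.eventually_lt_const hε, hG] with n hn hGn x hx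
  rw [dist_comm, Real.dist_eq]
  calc |c n * G n x - c₀ * g x| = |c n * (G n x - g x) + (c n - c₀) * g x| := by ring_nf
    _ ≤ |c n| * |G n x - g x| + |c n - c₀| * |g x| := by
      rw [← abs_mul, ← abs_mul]
      exact abs_add_le _ _
    _ ≤ |c n| * e n + |c n - c₀| * B := by gcongr <;> [exact hGn x hx; exact hg x hx]
    _ < ε := hn

theorem stmt15 (p : ℝ) (hp : 1 ≤ p)
    (Q : Measure ℝ) [IsProbabilityMeasure Q]
    (hQsupp : Q (Set.Icc 0 (π/2))ᶜ = 0)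
    (hQ0 : Q {0} = 0)
    (hQmean : ∫ ψ, momF p ψ ∂Q = 0)
    (hQvar : 0 < ∫ ψ, (momF p ψ) ^ 2 ∂Q)
    (h : ℝ → ℝ) (hcont : ContinuousOn h (Set.Icc 0 (π/2)))
    (h0 : h 0 = 0) (hπ : h (π/2) = 0)
    (t : ℕ → ℝ) (ht : ∀ n, 0 < t n) (ht0 : Filter.Tendsto t Filter.atTop (nhds 0))
    (hn : ℕ → ℝ → ℝ)
    (hhn : TendstoUniformlyOn hn h Filter.atTop (Set.Icc 0 (π/2)))
    (μ : ℕ → Measure ℝ) (hμprob : ∀ n, IsProbabilityMeasure (μ n))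
    (hμsupp : ∀ n, (μ n) (Set.Icc 0 (π/2))ᶜ = 0)
    (hμcdf : ∀ n, ∀ θ ∈ Set.Icc (0:ℝ) (π/2),
      ((μ n) (Set.Icc 0 θ)).toReal = (Q (Set.Icc 0 θ)).toReal + t n * hn n θ)
    (hμvar : ∀ n, 0 < ∫ ψ, (momF p ψ - ∫ ψ', momF p ψ' ∂(μ n)) ^ 2 ∂(μ n)) :
    TendstoUniformlyOn
      (fun n θ => (PsiMap p (μ n) θ - PsiMap p Q θ) / t n)
      (fun θ => h θ + (∫ ψ, (momF p ψ) ^ 2 ∂Q)⁻¹ *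
        (∫ ψ in Set.Icc 0 (π/2), h ψ * momF' p ψ) *
        ∫ ψ in Set.Icc 0 θ, momF p ψ ∂Q)
      Filter.atTop (Set.Icc 0 (π/2)) := by
  have hπ2 : (0 : ℝ) ≤ π / 2 := by positivity
  have hfc := continuousOn_momF hp
  have hf'c := continuousOn_momF' hp
  have hfd : ∀ x ∈ Set.Ioo 0 (π / 2), HasDerivAt (momF p) (momF' p x) x :=
    fun x hx => hasDerivAt_momF hp hx
  have hrestr : ∀ ν : Measure ℝ, ν (Set.Icc 0 (π / 2))ᶜ = 0 →
      ν.restrict (Set.Icc 0 (π / 2)) = ν := fun ν hν =>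
    Measure.restrict_eq_self_of_ae_mem (mem_ae_iff.2 hν)
  have hQr := hrestr Q hQsupp
  have hμr := fun n => hrestr (μ n) (hμsupp n)
  have hmass : ∀ ν : Measure ℝ, IsProbabilityMeasure ν → ∀ s, (ν s).toReal ≤ 1 :=
    fun ν _ s => measureReal_le_one
  have hint : ∀ ν : Measure ℝ, IsFiniteMeasure ν → ∀ g : ℝ → ℝ,
      ContinuousOn g (Set.Icc 0 (π / 2)) → ∀ θ ∈ Set.Icc 0 (π / 2),
      IntegrableOn g (Set.Icc 0 θ) ν := fun ν _ g hg θ hθ =>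
    (hg.mono (Set.Icc_subset_Icc_right hθ.2)).integrableOn_Icc
  obtain ⟨C, hC⟩ := isCompact_Icc.exists_bound_of_continuousOn hfc
  obtain ⟨C', hC'⟩ := isCompact_Icc.exists_bound_of_continuousOn hf'c
  obtain ⟨H, hH⟩ := isCompact_Icc.exists_bound_of_continuousOn hcont
  simp only [Real.norm_eq_abs] at hC hC' hH
  have hz : (0 : ℝ) ∈ Set.Icc 0 (π / 2) := ⟨le_rfl, hπ2⟩
  have hr : π / 2 ∈ Set.Icc 0 (π / 2) := ⟨hπ2, le_rfl⟩
  have hC0 : 0 ≤ C := (abs_nonneg _).trans (hC 0 hz)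
  have hC'0 : 0 ≤ C' := (abs_nonneg _).trans (hC' 0 hz)
  have hH0 : 0 ≤ H := (abs_nonneg _).trans (hH 0 hz)
  have hbdd : ∀ᶠ n in Filter.atTop, ∀ x ∈ Set.Icc 0 (π / 2), |hn n x| ≤ H + 1 := by
    filter_upwards [Metric.tendstoUniformlyOn_iff.1 hhn 1 one_pos] with n hnn x hx
    have h1 := hnn x hx
    rw [dist_comm, Real.dist_eq] at h1
    have h2 := abs_sub_abs_le_abs_sub (hn n x) (h x)
    linarith [hH x hx]
  have hsub : ∀ n, ∀ g g' : ℝ → ℝ, ContinuousOn g (Set.Icc 0 (π / 2)) →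
      ContinuousOn g' (Set.Icc 0 (π / 2)) → (∀ x ∈ Set.Ioo 0 (π / 2), HasDerivAt g (g' x) x) →
      ∀ θ ∈ Set.Icc 0 (π / 2), ∫ ψ in Set.Icc 0 θ, g ψ ∂(μ n) - ∫ ψ in Set.Icc 0 θ, g ψ ∂Q =
        t n * (g θ * hn n θ - ∫ x in Set.Icc 0 θ, hn n x * g' x) := by
    intro n g g' hg hg' hd θ hθ
    have hs : Set.Icc 0 θ ⊆ Set.Icc 0 (π / 2) := Set.Icc_subset_Icc_right hθ.2
    exact setIntegral_Icc_sub_of_cdf_eq_add (μ n) Q hθ.1 (hg.mono hs) (hg'.mono hs)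
      (fun x hx => hd x ⟨hx.1, hx.2.trans_le hθ.2⟩) fun x hx => hμcdf n x (hs hx)
  have hlimInt : ∀ g' : ℝ → ℝ, ContinuousOn g' (Set.Icc 0 (π / 2)) →
      Filter.Tendsto (fun n => ∫ x in Set.Icc 0 (π / 2), hn n x * g' x) Filter.atTop
        (nhds (∫ x in Set.Icc 0 (π / 2), h x * g' x)) := by
    intro g' hg'
    obtain ⟨D, hD⟩ := isCompact_Icc.exists_bound_of_continuousOn hg'
    refine tendsto_integral_filter_of_dominated_convergence (fun _ => (H + 1) * D)
      (Filter.Eventually.of_forall fun n => ?_) ?_ (integrable_const _) ?_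
    · have hm : AEStronglyMeasurable (fun x => ((μ n (Set.Icc 0 x)).toReal -
          (Q (Set.Icc 0 x)).toReal) / t n) (volume.restrict (Set.Icc 0 (π / 2))) :=
        (((measurable_toReal_measure_Icc (μ n) 0).sub
          (measurable_toReal_measure_Icc Q 0)).div_const _).aestronglyMeasurable
      refine (hm.mul (hg'.aestronglyMeasurable measurableSet_Icc)).congr ?_
      filter_upwards [ae_restrict_mem measurableSet_Icc] with x hx
      have htn := (ht n).ne'
      simp only [Pi.mul_apply]
      rw [hμcdf n x hx]
      field_simp
      ring
    · filter_upwards [hbdd] with n hnb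
      filter_upwards [ae_restrict_mem measurableSet_Icc] with x hx
      rw [norm_mul]
      have := hnb x hx
      gcongr
      · exact this
      · exact hD x hx
    · filter_upwards [ae_restrict_mem measurableSet_Icc] with x hx
      exact (hhn.tendsto_at hx).mul_const _
  have hhnπ : Filter.Tendsto (fun n => hn n (π / 2)) Filter.atTop (nhds 0) := by
    simpa [hπ] using hhn.tendsto_at hr
  have hlim : ∀ g g' : ℝ → ℝ, ContinuousOn g (Set.Icc 0 (π / 2)) →
      ContinuousOn g' (Set.Icc 0 (π / 2)) → (∀ x ∈ Set.Ioo 0 (π / 2), HasDerivAt g (g' x) x) →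
      Filter.Tendsto (fun n => (∫ ψ, g ψ ∂(μ n) - ∫ ψ, g ψ ∂Q) / t n) Filter.atTop
        (nhds (-∫ x in Set.Icc 0 (π / 2), h x * g' x)) := by
    intro g g' hg hg' hd
    have h1 := (hhnπ.const_mul (g (π / 2))).sub (hlimInt g' hg')
    rw [mul_zero, zero_sub] at h1
    refine h1.congr fun n => ?_
    have h2 := hsub n g g' hg hg' hd _ hr
    rw [hμr, hQr] at h2
    rw [h2, mul_div_cancel_left₀ _ (ht n).ne']
  have hlim0 : ∀ g g' : ℝ → ℝ, ContinuousOn g (Set.Icc 0 (π / 2)) →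
      ContinuousOn g' (Set.Icc 0 (π / 2)) → (∀ x ∈ Set.Ioo 0 (π / 2), HasDerivAt g (g' x) x) →
      Filter.Tendsto (fun n => ∫ ψ, g ψ ∂(μ n)) Filter.atTop (nhds (∫ ψ, g ψ ∂Q)) := by
    intro g g' hg hg' hd
    have h1 := ((hlim g g' hg hg' hd).mul ht0).add_const (∫ ψ, g ψ ∂Q)
    rw [mul_zero, zero_add] at h1
    refine h1.congr fun n => ?_
    rw [div_mul_cancel₀ _ (ht n).ne', sub_add_cancel]
  have hmdiv : Filter.Tendsto (fun n => (∫ ψ, momF p ψ ∂(μ n)) / t n) Filter.atTop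
      (nhds (-∫ x in Set.Icc 0 (π / 2), h x * momF' p x)) := by
    simpa [hQmean] using hlim _ _ hfc hf'c hfd
  have hm0 : Filter.Tendsto (fun n => ∫ ψ, momF p ψ ∂(μ n)) Filter.atTop (nhds 0) := by
    simpa [hQmean] using hlim0 _ _ hfc hf'c hfd
  have hsq : Filter.Tendsto (fun n => ∫ ψ, momF p ψ ^ 2 ∂(μ n)) Filter.atTop
      (nhds (∫ ψ, momF p ψ ^ 2 ∂Q)) :=
    hlim0 (fun x => momF p x ^ 2) (fun x => 2 * momF p x * momF' p x) (hfc.pow 2)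
      ((continuousOn_const.mul hfc).mul hf'c) fun x hx => ((hfd x hx).pow 2).congr_deriv (by simp)
  have hvar : Filter.Tendsto (fun n => ∫ ψ, (momF p ψ - ∫ ψ', momF p ψ' ∂(μ n)) ^ 2 ∂(μ n))
      Filter.atTop (nhds (∫ ψ, momF p ψ ^ 2 ∂Q)) := by
    have h1 := hsq.sub (hm0.pow 2)
    rw [zero_pow two_ne_zero, sub_zero] at h1
    refine h1.congr fun n => ?_
    have i1 := hint (μ n) inferInstance _ hfc _ hr
    have i2 := hint (μ n) inferInstance (fun ψ => momF p ψ ^ 2) (hfc.pow 2) _ hr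
    rw [IntegrableOn, hμr] at i1 i2
    generalize hm : ∫ ψ', momF p ψ' ∂(μ n) = m
    have e : ∀ ψ, (momF p ψ - m) ^ 2 = momF p ψ ^ 2 - 2 * m * momF p ψ + m ^ 2 :=
      fun ψ => by ring
    simp only [e]
    rw [integral_add (f := fun ψ => momF p ψ ^ 2 - 2 * m * momF p ψ)
      (i2.sub (i1.const_mul _)) (integrable_const _),
      integral_sub i2 (i1.const_mul _), integral_const_mul, hm]
    simp
    ring
  have hscal := (hmdiv.div hvar hQvar.ne').neg
  have hI : ∀ᶠ n in Filter.atTop, ∀ θ ∈ Set.Icc 0 (π / 2),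
      |(∫ ψ in Set.Icc 0 θ, (momF p ψ - ∫ ψ', momF p ψ' ∂(μ n)) ∂(μ n)) -
        ∫ ψ in Set.Icc 0 θ, momF p ψ ∂Q| ≤
      t n * (C * (H + 1) + (H + 1) * C' * (π / 2)) + |∫ ψ, momF p ψ ∂(μ n)| := by
    filter_upwards [hbdd] with n hnb θ hθ
    have hs := hsub n _ _ hfc hf'c hfd θ hθ
    rw [integral_sub (hint (μ n) inferInstance _ hfc _ hθ) (integrable_const _)]
    generalize ∫ ψ', momF p ψ' ∂(μ n) = m
    have hb : |∫ x in Set.Icc 0 θ, hn n x * momF' p x| ≤ (H + 1) * C' * (π / 2) := by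
      have h1 := norm_setIntegral_le_of_norm_le_const (μ := volume) (s := Set.Icc 0 θ)
        (f := fun x => hn n x * momF' p x) (C := (H + 1) * C') (by simp) fun x hx => by
          have hx' := Set.Icc_subset_Icc_right hθ.2 hx
          rw [norm_mul]
          exact mul_le_mul (hnb x hx') (hC' x hx') (abs_nonneg _) (by positivity)
      rw [Real.volume_real_Icc_of_le hθ.1, sub_zero] at h1
      exact h1.trans (mul_le_mul_of_nonneg_left hθ.2 (by positivity))
    have hb2 : |momF p θ * hn n θ| ≤ C * (H + 1) := by
      rw [abs_mul]
      exact mul_le_mul (hC θ hθ) (hnb θ hθ) (abs_nonneg _) hC0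
    have hconst : ∫ _ in Set.Icc 0 θ, m ∂(μ n) = (μ n (Set.Icc 0 θ)).toReal * m := by
      simp [Measure.real]
    rw [hconst, sub_right_comm, hs]
    refine (abs_sub _ _).trans (add_le_add ?_ ?_)
    · rw [abs_mul, abs_of_pos (ht n)]
      exact mul_le_mul_of_nonneg_left ((abs_sub _ _).trans (add_le_add hb2 hb)) (ht n).le
    · rw [abs_mul, abs_of_nonneg ENNReal.toReal_nonneg]
      exact mul_le_of_le_one_left (abs_nonneg _) (hmass (μ n) inferInstance _)
  have hIQ : ∀ θ ∈ Set.Icc 0 (π / 2), |∫ ψ in Set.Icc 0 θ, momF p ψ ∂Q| ≤ C := by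
    intro θ hθ
    have h1 := norm_setIntegral_le_of_norm_le_const (μ := Q) (s := Set.Icc 0 θ) (f := momF p)
      (C := C) (measure_lt_top _ _) fun x hx => hC x (Set.Icc_subset_Icc_right hθ.2 hx)
    exact h1.trans (mul_le_of_le_one_right hC0 (hmass Q inferInstance _))
  have he : Filter.Tendsto (fun n => t n * (C * (H + 1) + (H + 1) * C' * (π / 2)) +
      |∫ ψ, momF p ψ ∂(μ n)|) Filter.atTop (nhds 0) := by
    simpa using (ht0.mul_const (C * (H + 1) + (H + 1) * C' * (π / 2))).add hm0.abs
  have hfinal := hhn.add (TendstoUniformlyOn.scalar_mul_of_bounded hscal he hI hIQ)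
  refine (hfinal.congr (Filter.Eventually.of_forall fun n θ hθ => ?_)).congr_right fun θ _ => ?_
  · have htn := (ht n).ne'
    have hv := (hμvar n).ne'
    simp only [Pi.add_apply, Pi.div_apply, PsiMap, hQmean, zero_div, zero_mul, sub_zero]
    rw [hμcdf n θ hθ]
    field_simp
    ring
  · simp only [Pi.add_apply]
    ring
end

section
/- For every real x ≥ 1 and every η ∈ [0, 1/2], the quantity g(η) = x^{1−2η} + (x+1)^{1−2η} − 2 x^{1−η} (x+1)^{−η} admits the decomposition g(η) = ((x+1)^{1/2−η} − x^{1/2−η})² + 2√x · (x(x+1))^{−η} · (√(x+1) − √x); consequently g is nonincreasing in η on [0, 1/2], and g(η) ≤ g(0) = 1 for all η ∈ [0, 1/2]. -/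
/-- Splitting the weighted quantity into a square and a nonnegative remainder. -/
theorem weighted_sub_decomposition {a b : ℝ} (ha : 0 < a) (hb : 0 < b) (η : ℝ) :
    a ^ (1 - 2*η) + b ^ (1 - 2*η) - 2 * a ^ (1-η) * b ^ (-η) =
      (b ^ (1/2 - η) - a ^ (1/2 - η)) ^ 2 +
        2 * Real.sqrt a * (a*b) ^ (-η) * (Real.sqrt b - Real.sqrt a) := by
  have half {c : ℝ} (hc : 0 < c) : c ^ (1/2 - η) = Real.sqrt c * c ^ (-η) := by
    rw [Real.sqrt_eq_rpow, ← Real.rpow_add hc, ← sub_eq_add_neg]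
  have double {c : ℝ} (hc : 0 < c) : c ^ (1 - 2*η) = (c ^ (1/2 - η)) ^ 2 := by
    rw [← Real.rpow_mul_natCast hc.le]
    congr 1
    push_cast
    ring
  have one : a ^ (1-η) = Real.sqrt a ^ 2 * a ^ (-η) := by
    rw [Real.sq_sqrt ha.le, sub_eq_add_neg, Real.rpow_add ha, Real.rpow_one]
  rw [double ha, double hb, half ha, half hb, one, Real.mul_rpow ha.le hb.le]
  ring

/-- For `1 ≤ a ≤ b`, the gap between the powers of `a` and `b` grows with the exponent. -/
theorem monotoneOn_rpow_sub_rpow {a b : ℝ} (ha : 1 ≤ a) (hab : a ≤ b) :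
    MonotoneOn (fun s : ℝ => b ^ s - a ^ s) (Set.Ici 0) := by
  intro s hs t _ hst
  have ha0 : 0 < a := by linarith
  have hr : 1 ≤ b / a := (one_le_div ha0).2 hab
  have factor (u : ℝ) : b ^ u - a ^ u = a ^ u * ((b / a) ^ u - 1) := by
    rw [mul_sub, ← Real.mul_rpow ha0.le (by positivity), mul_div_cancel₀ _ ha0.ne', mul_one]
  simp only [factor]
  have h1 : 0 ≤ (b / a) ^ s - 1 := sub_nonneg.2 (Real.one_le_rpow hr hs)
  gcongr

theorem stmt16 (x : ℝ) (hx : 1 ≤ x) :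
    (∀ η ∈ Set.Icc (0:ℝ) (1/2),
      x ^ (1 - 2*η) + (x+1) ^ (1 - 2*η) - 2 * x ^ (1-η) * (x+1) ^ (-η) =
        ((x+1) ^ (1/2 - η) - x ^ (1/2 - η)) ^ 2 +
          2 * Real.sqrt x * (x*(x+1)) ^ (-η) * (Real.sqrt (x+1) - Real.sqrt x)) ∧
    AntitoneOn (fun η : ℝ => x ^ (1 - 2*η) + (x+1) ^ (1 - 2*η) - 2 * x ^ (1-η) * (x+1) ^ (-η))
      (Set.Icc 0 (1/2)) ∧
    (∀ η ∈ Set.Icc (0:ℝ) (1/2),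
      x ^ (1 - 2*η) + (x+1) ^ (1 - 2*η) - 2 * x ^ (1-η) * (x+1) ^ (-η) ≤ 1) ∧
    x ^ (1 - 2*(0:ℝ)) + (x+1) ^ (1 - 2*(0:ℝ)) - 2 * x ^ (1-(0:ℝ)) * (x+1) ^ (-(0:ℝ)) = 1 := by
  have hx0 : 0 < x := by linarith
  have decomp (η : ℝ) := weighted_sub_decomposition hx0 (show 0 < x + 1 by linarith) η
  have anti : AntitoneOn
      (fun η : ℝ => x ^ (1 - 2*η) + (x+1) ^ (1 - 2*η) - 2 * x ^ (1-η) * (x+1) ^ (-η))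
      (Set.Icc 0 (1/2)) := by
    intro η _ θ hθ hηθ
    simp only [decomp]
    have gap : (x+1) ^ (1/2 - θ) - x ^ (1/2 - θ) ≤ (x+1) ^ (1/2 - η) - x ^ (1/2 - η) :=
      monotoneOn_rpow_sub_rpow hx (by linarith) (sub_nonneg.2 hθ.2)
        (sub_nonneg.2 (hηθ.trans hθ.2)) (by linarith)
    have gap_nonneg : 0 ≤ (x+1) ^ (1/2 - θ) - x ^ (1/2 - θ) :=
      sub_nonneg.2 (Real.rpow_le_rpow hx0.le (by linarith) (sub_nonneg.2 hθ.2))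
    have sqrt_gap_nonneg : 0 ≤ Real.sqrt (x+1) - Real.sqrt x :=
      sub_nonneg.2 (Real.sqrt_le_sqrt (by linarith))
    have weight : (x*(x+1)) ^ (-θ) ≤ (x*(x+1)) ^ (-η) :=
      Real.rpow_le_rpow_of_exponent_le (by nlinarith) (by linarith)
    gcongr
  have at_zero :
      x ^ (1 - 2*(0:ℝ)) + (x+1) ^ (1 - 2*(0:ℝ)) - 2 * x ^ (1-(0:ℝ)) * (x+1) ^ (-(0:ℝ)) = 1 := by
    simp only [mul_zero, sub_zero, neg_zero, Real.rpow_one, Real.rpow_zero]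
    ring
  refine ⟨fun η _ => decomp η, anti, fun η hη => ?_, at_zero⟩
  exact (anti ⟨le_rfl, by norm_num⟩ hη hη.1).trans_eq at_zero
end

section
/- Let 0 < γ < 1 and set η = 1 − γ. Define w : (0, ∞) → (0, ∞) by w(x) = 1/max(x^η, x^γ), and define d(x, y) = w(x)² x + w(y)² y − 2 w(x) w(y) min(x, y) for x, y > 0. Then the inversion map x ↦ 1/x is an isometry of ((0,∞), d): d(1/x, 1/y) = d(x, y) for all x, y > 0. -/
/-- For complementary exponents, the larger of two powers at `x⁻¹` is the one at `x` over `x`. -/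
lemma max_rpow_inv_of_add_eq_one {a b x : ℝ} (hab : a + b = 1) (hx : 0 < x) :
    max (x⁻¹ ^ a) (x⁻¹ ^ b) = max (x ^ a) (x ^ b) / x := by
  have key : ∀ {s t : ℝ}, s + t = 1 → x⁻¹ ^ s = x ^ t / x := by
    intro s t hst
    rw [Real.inv_rpow hx.le, ← Real.rpow_neg hx.le, ← Real.rpow_sub_one hx.ne']
    congr 1
    linarith
  rw [key hab, key ((add_comm b a).trans hab), max_comm, max_div_div_right hx.le]

lemma mul_mul_min_inv_inv {x y : ℝ} (hx : 0 < x) (hy : 0 < y) :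
    x * y * min x⁻¹ y⁻¹ = min x y := by
  rw [mul_min_of_nonneg _ _ (mul_pos hx hy).le, mul_inv_cancel_right₀ hy.ne',
    mul_comm x y, mul_inv_cancel_right₀ hx.ne', min_comm]

theorem stmt18 (γ : ℝ) (hγ : γ ∈ Set.Ioo (0:ℝ) 1) (η : ℝ) (hη : η = 1 - γ)
    (w : ℝ → ℝ) (hw : ∀ x : ℝ, 0 < x → w x = 1 / max (x ^ η) (x ^ γ))
    (d : ℝ → ℝ → ℝ)
    (hd : ∀ x y : ℝ, 0 < x → 0 < y →
      d x y = (w x) ^ 2 * x + (w y) ^ 2 * y - 2 * w x * w y * min x y) :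
    ∀ x y : ℝ, 0 < x → 0 < y → d x⁻¹ y⁻¹ = d x y := by
  have hw_inv : ∀ x : ℝ, 0 < x → w x⁻¹ = x * w x := by
    intro x hx
    rw [hw _ (inv_pos.2 hx), hw _ hx, max_rpow_inv_of_add_eq_one (by linarith) hx,
      one_div_div, mul_one_div]
  have hsq : ∀ x : ℝ, 0 < x → (x * w x) ^ 2 * x⁻¹ = (w x) ^ 2 * x := by
    intro x hx
    field_simp
  intro x y hx hy
  rw [hd _ _ (inv_pos.2 hx) (inv_pos.2 hy), hd _ _ hx hy, hw_inv x hx, hw_inv y hy,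
    hsq x hx, hsq y hy, ← mul_mul_min_inv_inv hx hy]
  ring
end
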